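/- arXiv:2604.03178 — 2 statements merged into one kernel-verified Lean document; each statement's English description precedes it below -/
import Mathlib

section
/- Let C ≥ 1. There exist constants c₁, c₂ > 0 depending only on C such that the following holds. Let k ≥ 1 be an integer and let ε₁,…,ε_k > 0 satisfy (1/C)·(ε_total/k) ≤ ε_i ≤ C·(ε_total/k) for all i, where ε_total = ∑_{i=1}^k ε_i. Then for all x ≥ 1, the dual lattice count G(x) = #{u ∈ ℤ^k : ∑_{i=1}^k u_i²/ε_i² ≤ x} satisfies G(x) ≤ 2^k · σ^k · x^(k/2), where σ = c₁·max(1, ε_total/k) + c₂/√x. -/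
open Real Finset

/-- A set of integer vectors all of whose coordinates have absolute value at most `A` has at most
`(2 * (A + 1)) ^ k` elements. -/
theorem natCard_subtype_le_of_abs_le {k : ℕ} {A : ℝ} (hA : 0 ≤ A) (P : (Fin k → ℤ) → Prop)
    (hP : ∀ u, P u → ∀ i, |(u i : ℝ)| ≤ A) :
    (Nat.card {u : Fin k → ℤ // P u} : ℝ) ≤ (2 * (A + 1)) ^ k := by
  let S : Finset (Fin k → ℤ) := Fintype.piFinset fun _ => Finset.Icc (-⌊A⌋) ⌊A⌋
  have hmem : ∀ u, P u → u ∈ S := by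
    intro u hu
    refine Fintype.mem_piFinset.2 fun i => ?_
    obtain ⟨hl, hr⟩ := abs_le.1 (hP u hu i)
    refine Finset.mem_Icc.2 ⟨neg_le.1 (Int.le_floor.2 ?_), Int.le_floor.2 hr⟩
    push_cast
    linarith
  have hcard : Nat.card {u : Fin k → ℤ // P u} ≤ S.card := by
    rw [← Nat.card_eq_finsetCard S]
    exact Nat.card_le_card_of_injective (Subtype.map id hmem)
      (Subtype.map_injective hmem Function.injective_id)
  have hS : (S.card : ℝ) = (2 * (⌊A⌋ : ℝ) + 1) ^ k := by
    have h0 : 0 ≤ ⌊A⌋ := Int.floor_nonneg.2 hA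
    have h1 : ((⌊A⌋ + 1 - -⌊A⌋).toNat : ℝ) = 2 * (⌊A⌋ : ℝ) + 1 := by
      rw [← Int.cast_natCast, Int.toNat_of_nonneg (by omega)]
      push_cast
      ring
    simp only [S, Fintype.card_piFinset, Int.card_Icc, Finset.prod_const, Finset.card_univ,
      Fintype.card_fin, Nat.cast_pow, h1]
  have h0 : (0 : ℝ) ≤ ⌊A⌋ := by exact_mod_cast Int.floor_nonneg.2 hA
  calc (Nat.card {u : Fin k → ℤ // P u} : ℝ) ≤ S.card := by exact_mod_cast hcard
    _ = (2 * (⌊A⌋ : ℝ) + 1) ^ k := hS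
    _ ≤ (2 * (A + 1)) ^ k := by
      gcongr
      linarith [Int.floor_le A]

/-- Each coordinate of a point of an axis-parallel ellipsoid is bounded by its semi-axis. -/
theorem abs_le_mul_sqrt_of_sum_sq_div_sq_le {ι : Type*} [Fintype ι] {ε v : ι → ℝ} {x : ℝ}
    (hε : ∀ i, 0 < ε i) (h : ∑ i, v i ^ 2 / ε i ^ 2 ≤ x) (i : ι) : |v i| ≤ ε i * √x := by
  have hi : v i ^ 2 / ε i ^ 2 ≤ x :=
    (Finset.single_le_sum (f := fun j => v j ^ 2 / ε j ^ 2) (fun j _ => by positivity)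
      (Finset.mem_univ i)).trans h
  rw [← div_pow] at hi
  have habs := Real.abs_le_sqrt hi
  rwa [abs_div, abs_of_pos (hε i), div_le_iff₀' (hε i)] at habs

/-- For every `C ≥ 1` there exist `c₁, c₂ > 0` (depending only on `C`)
such that for every integer `k ≥ 1`, all precisions `ε i > 0` satisfying the balanced
precision condition `(1/C)·(ε_total/k) ≤ ε i ≤ C·(ε_total/k)` with `ε_total = ∑ ε i`,
and all `x ≥ 1`, the dual lattice count `G(x) = #{u ∈ ℤ^k : ∑ uᵢ²/εᵢ² ≤ x}` satisfies
`G(x) ≤ 2^k · σ^k · x^(k/2)` where `σ = c₁·max(1, ε_total/k) + c₂/√x`. -/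
theorem stmt7 (C : ℝ) (hC : 1 ≤ C) :
    ∃ c₁ : ℝ, 0 < c₁ ∧ ∃ c₂ : ℝ, 0 < c₂ ∧
      ∀ (k : ℕ), 1 ≤ k → ∀ ε : Fin k → ℝ, (∀ i, 0 < ε i) →
        (∀ i, (1 / C) * ((∑ j, ε j) / k) ≤ ε i ∧ ε i ≤ C * ((∑ j, ε j) / k)) →
        ∀ x : ℝ, 1 ≤ x →
          (Nat.card {u : Fin k → ℤ // ∑ i, (u i : ℝ) ^ 2 / ε i ^ 2 ≤ x} : ℝ)
            ≤ 2 ^ k * (c₁ * max 1 ((∑ j, ε j) / k) + c₂ / Real.sqrt x) ^ k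
              * x ^ ((k : ℝ) / 2) := by
  refine ⟨C, by linarith, 1, one_pos, fun k _ ε hε hbal x hx => ?_⟩
  set M : ℝ := max 1 ((∑ j, ε j) / k)
  have hM : 1 ≤ M := le_max_left _ _
  have hx0 : 0 < √x := Real.sqrt_pos.2 (by linarith)
  have hcoord : ∀ u : Fin k → ℤ, ∑ i, (u i : ℝ) ^ 2 / ε i ^ 2 ≤ x →
      ∀ i, |(u i : ℝ)| ≤ C * M * √x := by
    intro u hu i
    refine (abs_le_mul_sqrt_of_sum_sq_div_sq_le hε hu i).trans ?_
    gcongr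
    exact (hbal i).2.trans (mul_le_mul_of_nonneg_left (le_max_right _ _) (by linarith))
  refine (natCard_subtype_le_of_abs_le (by positivity) _ hcoord).trans_eq ?_
  rw [Real.rpow_div_two_eq_sqrt _ (by linarith), Real.rpow_natCast, ← mul_pow, ← mul_pow]
  congr 1
  field_simp
end

section
/- Let 0 < l₁ ≤ l₂ ≤ ⋯ be a non-decreasing sequence of positive reals with finite counting function B(x) = #{n : l_n ≤ x} for every x. Let ρ ≥ 1 be an integer, z > 0, and define B_ρ(x) = (1/ρ!)·∑_{n : l_n ≤ x} (x − l_n)^ρ. Then for every x > 0, z^ρ·B(x) ≤ Δ[B_ρ](x), where Δ[H](x) = ∑_{ν=0}^{ρ} (−1)^(ρ−ν)·C(ρ,ν)·H(x + ν·z) is the difference operator of order ρ with step z. -/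
open Real Finset

/-- Iterated forward differences commute with differentiation. -/
theorem hasDerivAt_fwdDiff_iter {f f' : ℝ → ℝ} (h : ℝ) (hf : ∀ t, HasDerivAt f (f' t) t)
    (n : ℕ) (t : ℝ) : HasDerivAt ((fwdDiff h)^[n] f) ((fwdDiff h)^[n] f' t) t := by
  induction n generalizing f f' with
  | zero => exact hf t
  | succ n ih =>
    exact ih fun s => ((hf (s + h)).comp_add_const s h).sub (hf s)

/-- The truncated power `t ↦ t₊ ^ (k + 1)` is differentiable for `k ≥ 1`. -/
theorem hasDerivAt_max_zero_pow {k : ℕ} (hk : 1 ≤ k) (t : ℝ) :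
    HasDerivAt (fun s : ℝ => max s 0 ^ (k + 1)) ((k + 1 : ℝ) * max t 0 ^ k) t := by
  have hk0 : k ≠ 0 := by omega
  have hpow : HasDerivAt (fun s : ℝ => s ^ (k + 1)) ((k + 1 : ℝ) * t ^ k) t := by
    simpa using hasDerivAt_pow (k + 1) t
  rcases lt_trichotomy t 0 with ht | rfl | ht
  · rw [max_eq_right ht.le, zero_pow hk0, mul_zero]
    refine (hasDerivAt_const t (0 : ℝ)).congr_of_eventuallyEq ?_
    filter_upwards [Iio_mem_nhds ht] with s hs
    rw [max_eq_right (le_of_lt hs), zero_pow (by omega)]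
  · rw [max_self]
    have hright : HasDerivWithinAt (fun s : ℝ => max s 0 ^ (k + 1)) ((k + 1 : ℝ) * 0 ^ k)
        (Set.Ici 0) 0 :=
      hpow.hasDerivWithinAt.congr (fun s hs => by rw [max_eq_left hs]) (by simp)
    have hleft : HasDerivWithinAt (fun s : ℝ => max s 0 ^ (k + 1)) ((k + 1 : ℝ) * 0 ^ k)
        (Set.Iic 0) 0 := by
      rw [zero_pow hk0, mul_zero]
      exact (hasDerivWithinAt_const (0 : ℝ) _ (0 : ℝ)).congr
        (fun s hs => by rw [max_eq_right hs, zero_pow (by omega)]) (by simp)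
    simpa [← hasDerivWithinAt_univ] using hleft.union hright
  · rw [max_eq_left ht.le]
    refine hpow.congr_of_eventuallyEq ?_
    filter_upwards [Ioi_mem_nhds ht] with s hs
    rw [max_eq_left (le_of_lt hs)]

/-- The forward difference of order `k ≥ 1` of the truncated power `t₊ ^ k` is non-negative. -/
theorem fwdDiff_iter_max_zero_pow_nonneg {h : ℝ} (hh : 0 ≤ h) {k : ℕ} (hk : 1 ≤ k) (t : ℝ) :
    0 ≤ (fwdDiff h)^[k] (fun s : ℝ => max s 0 ^ k) t := by
  induction k, hk using Nat.le_induction generalizing t with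
  | base =>
    simpa [fwdDiff] using max_le_max_right (0 : ℝ) (le_add_of_nonneg_right hh : t ≤ t + h)
  | succ k hk ih =>
    have hderiv := hasDerivAt_fwdDiff_iter h (hasDerivAt_max_zero_pow hk) k
    have hmono : Monotone ((fwdDiff h)^[k] fun s : ℝ => max s 0 ^ (k + 1)) := by
      refine monotone_of_hasDerivAt_nonneg hderiv fun s => ?_
      have := fwdDiff_iter_const_smul h (k + 1 : ℝ) (fun s : ℝ => max s 0 ^ k) k
      change 0 ≤ (fwdDiff h)^[k] ((k + 1 : ℝ) • fun s : ℝ => max s 0 ^ k) s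
      rw [this]
      exact mul_nonneg (by positivity) (ih s)
    rw [Function.iterate_succ_apply']
    exact sub_nonneg.2 (hmono (by linarith))

/-- The alternating binomial sum is an iterated forward difference. -/
theorem sum_neg_one_pow_mul_choose_mul_eq_fwdDiff_iter (h : ℝ) (f : ℝ → ℝ) (k : ℕ) (t : ℝ) :
    ∑ ν ∈ Finset.range (k + 1), (-1 : ℝ) ^ (k - ν) * (k.choose ν) * f (t + ν * h)
      = (fwdDiff h)^[k] f t := by
  rw [fwdDiff_iter_eq_sum_shift]
  exact Finset.sum_congr rfl fun ν _ => by simp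

/-- The difference of order `k` with step `h` of `t ↦ t ^ k` is the constant `k! * h ^ k`. -/
theorem fwdDiff_iter_pow_eq_factorial_mul {h : ℝ} (hh : h ≠ 0) (k : ℕ) (t : ℝ) :
    (fwdDiff h)^[k] (fun s : ℝ => s ^ k) t = k.factorial * h ^ k := by
  have hone := congrFun (fwdDiff_iter_eq_factorial (R := ℝ) (n := k)) (t / h)
  rw [← sum_neg_one_pow_mul_choose_mul_eq_fwdDiff_iter] at hone ⊢
  have hk : (k.factorial : ℝ) = ((k.factorial : ℝ → ℝ)) (t / h) := by simp
  rw [hk, ← hone, Finset.sum_mul]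
  refine Finset.sum_congr rfl fun ν _ => ?_
  have : t + ν * h = (t / h + ν * 1) * h := by field_simp
  rw [this, mul_pow, mul_assoc _ _ (h ^ k)]

/-- On non-negative reals the truncated power has the same difference as the power. -/
theorem fwdDiff_iter_max_zero_pow_of_nonneg {h : ℝ} (hh : 0 < h) (k : ℕ) {t : ℝ} (ht : 0 ≤ t) :
    (fwdDiff h)^[k] (fun s : ℝ => max s 0 ^ k) t = k.factorial * h ^ k := by
  rw [← fwdDiff_iter_pow_eq_factorial_mul hh.ne' k t,
    ← sum_neg_one_pow_mul_choose_mul_eq_fwdDiff_iter,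
    ← sum_neg_one_pow_mul_choose_mul_eq_fwdDiff_iter]
  refine Finset.sum_congr rfl fun ν _ => ?_
  rw [max_eq_left (by positivity)]

/-- Let `0 < l₁ ≤ l₂ ≤ ⋯` be a non-decreasing sequence of positive reals
(indexed by `n ≥ 1`) with finite counting function `B(x) = #{n : lₙ ≤ x}`. Let `ρ ≥ 1`,
`z > 0`, and `B_ρ(x) = (1/ρ!)·∑_{lₙ ≤ x}(x − lₙ)^ρ`. Then for every `x > 0`,
`z^ρ·B(x) ≤ Δ[B_ρ](x)`, where `Δ` is the difference operator of order `ρ` with step `z`. -/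
theorem stmt18 (l : ℕ → ℝ)
    (hpos : ∀ n, 1 ≤ n → 0 < l n)
    (hmono : ∀ n, 1 ≤ n → l n ≤ l (n + 1))
    (hfin : ∀ x : ℝ, {n : ℕ | 1 ≤ n ∧ l n ≤ x}.Finite)
    (B : ℝ → ℕ) (hB : ∀ x, B x = Nat.card {n : ℕ // 1 ≤ n ∧ l n ≤ x})
    (ρ : ℕ) (hρ : 1 ≤ ρ) (z : ℝ) (hz : 0 < z)
    (Bρ : ℝ → ℝ)
    (hBρ : ∀ x : ℝ, Bρ x = (1 / (ρ.factorial : ℝ)) * ∑ n ∈ (hfin x).toFinset, (x - l n) ^ ρ)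
    (x : ℝ) (hx : 0 < x) :
    z ^ ρ * (B x : ℝ)
      ≤ ∑ ν ∈ Finset.range (ρ + 1), (-1 : ℝ) ^ (ρ - ν) * (ρ.choose ν) * Bρ (x + ν * z) := by
  have hρ0 : ρ ≠ 0 := by omega
  have hfac : (ρ.factorial : ℝ) ≠ 0 := by positivity
  set S := (hfin (x + ρ * z)).toFinset with hS
  have hsub : ∀ y ≤ x + ρ * z, (hfin y).toFinset ⊆ S := fun y hy n hn => by
    simp only [hS, Set.Finite.mem_toFinset, Set.mem_ofPred_eq] at hn ⊢
    exact ⟨hn.1, hn.2.trans hy⟩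
  have hsmooth : ∀ y ≤ x + ρ * z,
      Bρ y = (1 / (ρ.factorial : ℝ)) * ∑ n ∈ S, max (y - l n) 0 ^ ρ := by
    intro y hy
    rw [hBρ]
    congr 1
    rw [← Finset.sum_subset (hsub y hy)]
    · refine Finset.sum_congr rfl fun n hn => ?_
      simp only [Set.Finite.mem_toFinset, Set.mem_ofPred_eq] at hn
      rw [max_eq_left (by linarith)]
    · intro n hn hny
      simp only [hS, Set.Finite.mem_toFinset, Set.mem_ofPred_eq, not_and, not_le] at hn hny
      rw [max_eq_right (by linarith [hny hn.1]), zero_pow hρ0]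
  have hcard : B x = (hfin x).toFinset.card := by
    rw [hB]
    exact Nat.card_eq_card_finite_toFinset (hfin x)
  have hdiff : ∑ ν ∈ Finset.range (ρ + 1), (-1 : ℝ) ^ (ρ - ν) * (ρ.choose ν) * Bρ (x + ν * z)
      = (1 / (ρ.factorial : ℝ)) *
        ∑ n ∈ S, (fwdDiff z)^[ρ] (fun s : ℝ => max s 0 ^ ρ) (x - l n) := by
    simp_rw [← sum_neg_one_pow_mul_choose_mul_eq_fwdDiff_iter]
    rw [Finset.sum_comm, Finset.mul_sum]
    refine Finset.sum_congr rfl fun ν hν => ?_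
    have hνρ : (ν : ℝ) ≤ ρ := by exact_mod_cast Nat.lt_succ_iff.1 (Finset.mem_range.1 hν)
    rw [hsmooth _ (by gcongr), ← Finset.mul_sum]
    simp_rw [sub_add_eq_add_sub]
    ring
  rw [hdiff, hcard]
  calc z ^ ρ * ((hfin x).toFinset.card : ℝ)
      = (1 / (ρ.factorial : ℝ)) * ∑ n ∈ (hfin x).toFinset,
          (fwdDiff z)^[ρ] (fun s : ℝ => max s 0 ^ ρ) (x - l n) := by
        rw [Finset.sum_congr rfl fun n hn => fwdDiff_iter_max_zero_pow_of_nonneg hz ρ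
          (sub_nonneg.2 ((hfin x).mem_toFinset.1 hn).2), Finset.sum_const, nsmul_eq_mul]
        field_simp
    _ ≤ _ := by
        refine mul_le_mul_of_nonneg_left (Finset.sum_le_sum_of_subset_of_nonneg
          (hsub x (le_add_of_nonneg_right (by positivity))) fun n _ _ => ?_) (by positivity)
        exact fwdDiff_iter_max_zero_pow_nonneg hz.le hρ _
end
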